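/- Let s be a weak composition. The edge labeling λ of the s-weak order that assigns to each cover relation T ⋖ Z the label a, where (a,b) is the unique tree ascent of T such that Z is the s-tree rotation of T along (a,b), is an SB-labeling of the s-weak order lattice. -/

import Mathlib

open scoped Classical

/-- An `s`-decreasing tree with internal vertices `1,…,n` (the root is `n`), encoded by
recording, for each non-root internal vertex `v`, its parent `parent v` (an internal vertex
with a larger label, so that labels decrease away from the root) and the index `idx v` of
the child slot of `parent v` (among `0,…,s (parent v)`, left to right) containing `v`.
Distinct internal vertices occupy distinct child slots; all remaining slots are leaves. -/
structure SDecTree (n : ℕ) (s : ℕ → ℕ) where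
  parent : ℕ → ℕ
  idx : ℕ → ℕ
  parent_gt : ∀ v, 1 ≤ v → v < n → v < parent v
  parent_le : ∀ v, 1 ≤ v → v < n → parent v ≤ n
  idx_le : ∀ v, 1 ≤ v → v < n → idx v ≤ s (parent v)
  slot_inj : ∀ v w, 1 ≤ v → v < n → 1 ≤ w → w < n →
      parent v = parent w → idx v = idx w → v = w
  parent_out : ∀ v, v = 0 ∨ n ≤ v → parent v = 0
  idx_out : ∀ v, v = 0 ∨ n ≤ v → idx v = 0

namespace SDecTree

variable {n : ℕ} {s : ℕ → ℕ}

/-- `y` is a weak ancestor of `x`, i.e. `x` is a labeled vertex of the subtree `T^y`. -/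
def Descend (T : SDecTree n s) (x y : ℕ) : Prop :=
  ∃ k, T.parent^[k] x = y ∧ ∀ m ≤ k, 1 ≤ T.parent^[m] x ∧ T.parent^[m] x ≤ n

/-- `x` is a labeled vertex of the subtree `T^y_j` rooted at the `j`-th child of `y`. -/
def InSub (T : SDecTree n s) (y j x : ℕ) : Prop :=
  ∃ c, T.Descend x c ∧ T.parent c = y ∧ T.idx c = j

/-- `x` lies strictly left of `y` in the planar tree `T`. -/
def LeftOf (T : SDecTree n s) (x y : ℕ) : Prop :=
  ∃ z j₁ j₂, j₁ < j₂ ∧ T.InSub z j₁ x ∧ T.InSub z j₂ y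

/-- The cardinality `#_T(y,x)` of the pair `(y,x)`: it is `j` if `x ∈ T^y_j`
(so `0` if `x ∈ T^y_0` and `s y` if `x ∈ T^y_{s y}`), `0` if `x` is left of `y`, and
`s y` if `x` is right of `y`; it is `0` for out-of-range pairs. -/
noncomputable def card (T : SDecTree n s) (y x : ℕ) : ℕ :=
  if h : ∃ j, T.InSub y j x then h.choose
  else if 1 ≤ x ∧ x < y ∧ y ≤ n ∧ ¬ T.LeftOf x y then s y else 0

/-- `x` is a labeled vertex of `T^a ∖ 0`, i.e. of `T^a` with `T^a_0` replaced by a leaf. -/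
def InSubMinus0 (T : SDecTree n s) (a x : ℕ) : Prop :=
  x = a ∨ ∃ j, 0 < j ∧ T.InSub a j x

/-- `(a,b)` is a tree ascent of `T`. -/
def TreeAscent (T : SDecTree n s) (a b : ℕ) : Prop :=
  1 ≤ a ∧ a < b ∧ b ≤ n ∧
  (∃ i, i < s b ∧ T.InSub b i a) ∧
  (∀ e j, a < e → e < b → T.InSub e j a → j = s e) ∧
  (0 < s a → ∀ x, ¬ T.InSub a (s a) x)

end SDecTree

/-- A multi-inversion set (encoded by its multiplicity function) is transitive:
if `a < b < c` then `#(b,a) = 0` or `#(c,a) ≥ #(c,b)`. -/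
def IsTransitiveInv (I : ℕ → ℕ → ℕ) : Prop :=
  ∀ a b c, a < b → b < c → I b a = 0 ∨ I c b ≤ I c a

/-- The transitive closure of a multi-inversion set: the smallest (by inclusion, i.e.
pointwise on multiplicities) transitive multi-inversion set containing it. -/
noncomputable def tcInv (I : ℕ → ℕ → ℕ) : ℕ → ℕ → ℕ := fun y x =>
  sInf {m | ∃ J : ℕ → ℕ → ℕ, IsTransitiveInv J ∧ (∀ y' x', I y' x' ≤ J y' x') ∧ J y x = m}

/-- Add one copy of the inversion `(b,a)` to `I`, capping the multiplicity at `s b`. -/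
def addInv (s : ℕ → ℕ) (I : ℕ → ℕ → ℕ) (b a : ℕ) : ℕ → ℕ → ℕ := fun y x =>
  if y = b ∧ x = a then min (I y x + 1) (s y) else I y x

namespace SDecTree

variable {n : ℕ} {s : ℕ → ℕ}

/-- The `s`-weak order: `T ⪯ Z` iff `#_T(y,x) ≤ #_Z(y,x)` for all pairs. -/
def wle (T Z : SDecTree n s) : Prop := ∀ y x, T.card y x ≤ Z.card y x

/-- Strict `s`-weak order. -/
def wlt (T Z : SDecTree n s) : Prop := wle T Z ∧ ¬ wle Z T

/-- Cover relation in the `s`-weak order. -/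
def wcov (T Z : SDecTree n s) : Prop := wlt T Z ∧ ∀ U, wlt T U → wlt U Z → False

/-- `W` is the join of `T` and `Z` in the `s`-weak order. -/
def IsJoin (T Z W : SDecTree n s) : Prop :=
  wle T W ∧ wle Z W ∧ ∀ U, wle T U → wle Z U → wle W U

/-- `Z` is the `s`-tree rotation of `T` along the tree ascent `(a,b)`, i.e.
`inv Z = (inv T + (b,a))^tc`. -/
def IsRotation (T Z : SDecTree n s) (a b : ℕ) : Prop :=
  T.TreeAscent a b ∧
  ∀ y x, 1 ≤ x → x < y → y ≤ n → Z.card y x = tcInv (addInv s T.card b a) y x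

/-- The set `A_T(a,b)` of inversions added by a rotation producing `Z`: the pairs `(f,e)`
with `#_Z(f,e) > #_T(f,e)`. -/
def Aset (T Z : SDecTree n s) : Set (ℕ × ℕ) :=
  {p | T.card p.1 p.2 < Z.card p.1 p.2}

/-- The set `A_T(a,b)` described directly via the transitive closure. -/
def ARot (T : SDecTree n s) (a b : ℕ) : Set (ℕ × ℕ) :=
  {p | T.card p.1 p.2 < tcInv (addInv s T.card b a) p.1 p.2}

/-- The set `F_T(a,c)` (here `b` and `d` are the partners of `a` and `c` in the
respective tree ascents `(a,b)` and `(c,d)`): it is `{(d,e) : e ∈ T^a∖0}` if `b = c`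
and `a ∈ T^c_0`, and empty otherwise. -/
def Fset (T : SDecTree n s) (a b c d : ℕ) : Set (ℕ × ℕ) :=
  {p | b = c ∧ T.InSub c 0 a ∧ p.1 = d ∧ T.InSubMinus0 a p.2}

/-- `T` is an `s`-Tamari tree: `#_T(c,a) ≤ #_T(c,b)` whenever `a < b < c`. -/
def IsTamari (T : SDecTree n s) : Prop :=
  ∀ a b c, a < b → b < c → T.card c a ≤ T.card c b

/-- `(a,b)` is a Tamari tree ascent of `T`: `a` is a non-rightmost child of `b`. -/
def TamariAscent (T : SDecTree n s) (a b : ℕ) : Prop :=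
  1 ≤ a ∧ a < n ∧ T.parent a = b ∧ T.card b a < s b

/-- `Z` is the `s`-Tamari rotation of `T` along the Tamari tree ascent `(a,b)`. -/
def IsTamRotation (T Z : SDecTree n s) (a b : ℕ) : Prop :=
  T.TamariAscent a b ∧
  ∀ y x, 1 ≤ x → x < y → y ≤ n → Z.card y x = tcInv (addInv s T.card b a) y x

/-- Cover relation in the `s`-Tamari lattice. -/
def tamcov (T Z : SDecTree n s) : Prop :=
  IsTamari T ∧ IsTamari Z ∧ wlt T Z ∧ ∀ U, IsTamari U → wlt T U → wlt U Z → False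

/-- `W` is the join of `T` and `Z` in the `s`-Tamari lattice. -/
def IsTamJoin (T Z W : SDecTree n s) : Prop :=
  IsTamari W ∧ wle T W ∧ wle Z W ∧ ∀ U, IsTamari U → wle T U → wle Z U → wle W U

/-- The open interval `(T,Z)` in the `s`-weak order. -/
def OpenInterval (T Z : SDecTree n s) : Set (SDecTree n s) := {U | wlt T U ∧ wlt U Z}

/-- A set of trees forming a chain in the `s`-weak order. -/
def IsChainSet (C : Set (SDecTree n s)) : Prop :=
  C.Pairwise fun U V => wlt U V ∨ wlt V U

/-- The geometric realization of the order complex `Δ(T,Z)` of the open interval `(T,Z)`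
in the `s`-weak order: the space of finitely supported probability vectors on the vertex
set whose support is a chain of the open interval. -/
def orderComplex (T Z : SDecTree n s) : Set (SDecTree n s → ℝ) :=
  {f | (∀ U, 0 ≤ f U) ∧ (Function.support f).Finite ∧
    Function.support f ⊆ OpenInterval T Z ∧ IsChainSet (Function.support f) ∧
    ∑ᶠ U, f U = 1}

/-- The geometric realization of the order complex of the open interval `(T,Z)` in the
`s`-Tamari lattice. -/
def tamOrderComplex (T Z : SDecTree n s) : Set (SDecTree n s → ℝ) :=
  {f | (∀ U, 0 ≤ f U) ∧ (Function.support f).Finite ∧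
    Function.support f ⊆ {U | IsTamari U ∧ wlt T U ∧ wlt U Z} ∧
    IsChainSet (Function.support f) ∧ ∑ᶠ U, f U = 1}

end SDecTree

/-- The list of labels of the consecutive cover relations along a saturated chain,
recorded as a list of poset elements. -/
def labelsOf {α : Type*} (lab : α → α → ℕ) (L : List α) : List ℕ :=
  (L.zip L.tail).map fun p => lab p.1 p.2

namespace SDecTree

/-- Abstract tree-inversion sets. -/
structure IsInv (n : ℕ) (s : ℕ → ℕ) (I : ℕ → ℕ → ℕ) : Prop where
  zero : ∀ y x, ¬ (1 ≤ x ∧ x < y ∧ y ≤ n) → I y x = 0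
  le : ∀ y x, I y x ≤ s y
  tr : ∀ x y z, x < y → y < z → I y x = 0 ∨ I z y ≤ I z x
  pl : ∀ x y z, 1 ≤ x → x < y → y < z → z ≤ n → I y x = s y ∨ I z x ≤ I z y

/-- Descendant relation read off from the inversion set. -/
def DD (I : ℕ → ℕ → ℕ) (x y : ℕ) : Prop := ∀ z, y < z → I z x = I z y

theorem DD.refl (I : ℕ → ℕ → ℕ) (x : ℕ) : DD I x x := fun _ _ => rfl

theorem DD.trans {I : ℕ → ℕ → ℕ} {x y z : ℕ} (h : DD I x y) (h' : DD I y z) (hyz : y ≤ z) :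
    DD I x z := fun w hw => (h w (by omega)).trans (h' w hw)

theorem DD.cancel {I : ℕ → ℕ → ℕ} {x y z : ℕ} (h : DD I x y) (h' : DD I x z) (hyz : y ≤ z) :
    DD I y z := fun w hw => (h w (by omega)).symm.trans (h' w hw)

structure Asc (n : ℕ) (s : ℕ → ℕ) (I : ℕ → ℕ → ℕ) (a b : ℕ) : Prop where
  one : 1 ≤ a
  lt : a < b
  le : b ≤ n
  dd : DD I a b
  lts : I b a < s b
  mid : ∀ e, a < e → e < b → DD I a e → I e a = s e
  leaf : ∀ x, 1 ≤ x → x < a → DD I x a → 0 < s a → I a x < s a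

section inv
variable {n : ℕ} {s : ℕ → ℕ} {I : ℕ → ℕ → ℕ}

/-- the first separating vertex is a common ancestor -/
theorem IsInv.sep (h : IsInv n s I) {x y z : ℕ} (hx1 : 1 ≤ x) (hy1 : 1 ≤ y)
    (hx : x < z) (hy : y < z) (hlt : I z y < I z x)
    (hz : ∀ w, z < w → I w x = I w y) : DD I x z ∧ DD I y z := by
  have key : ∀ w, z < w → I w x = I w z := by
    intro w hw
    by_cases hwn : w ≤ n
    · have h1 := h.tr x z w hx hw
      have h2 := h.pl y z w hy1 hy hw hwn
      have h3 := h.le z x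
      have h4 := hz w hw
      omega
    · rw [h.zero _ _ (by omega), h.zero _ _ (by omega)]
  exact ⟨key, fun w hw => (hz w hw).symm.trans (key w hw)⟩

theorem IsInv.exists_sep (h : IsInv n s I) {x y m : ℕ} (hne : ∃ z, m < z ∧ I z x ≠ I z y) :
    ∃ z, m < z ∧ I z x ≠ I z y ∧ ∀ w, z < w → I w x = I w y := by
  classical
  obtain ⟨z0, hz0, hz0'⟩ := hne
  have hb : ∀ z, I z x ≠ I z y → z ≤ n := by
    intro z hz
    by_contra hc
    exact hz (by rw [h.zero _ _ (by omega), h.zero _ _ (by omega)])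
  have hP : ∃ z, z ≤ n ∧ I z x ≠ I z y := ⟨z0, hb _ hz0', hz0'⟩
  refine ⟨Nat.findGreatest (fun z => I z x ≠ I z y) n, ?_, ?_, ?_⟩
  · exact lt_of_lt_of_le hz0 (Nat.le_findGreatest (hb _ hz0') hz0')
  · exact Nat.findGreatest_spec (P := fun z => I z x ≠ I z y) (hb _ hz0') hz0'
  · intro w hw
    by_contra hc
    exact absurd (Nat.le_findGreatest (P := fun z => I z x ≠ I z y) (hb _ hc) hc) (by omega)

theorem IsInv.dd_of_mid (h : IsInv n s I) {x y : ℕ} (hx : 1 ≤ x) (hxy : x < y)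
    (h0 : 0 < I y x) (h1 : I y x < s y) : DD I x y := by
  intro w hw
  by_cases hwn : w ≤ n
  · have h1 := h.tr x y w hxy hw
    have h2 := h.pl x y w hx hxy hw hwn
    omega
  · rw [h.zero _ _ (by omega), h.zero _ _ (by omega)]

/-- Lemma L -/
theorem Asc.right {a b : ℕ} (A : Asc n s I a b) (h : IsInv n s I) {y : ℕ} (hy : 1 ≤ y) (hyb : y < b)
    (hle : ∀ z, a < z → y < z → I z a ≤ I z y)
    (hne : ∃ z, a < z ∧ y < z ∧ I z y ≠ I z a) : I b a < I b y := by
  obtain ⟨z, hz, hzne, hzmax⟩ := h.exists_sep (x := y) (y := a) (m := max a y)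
    (by obtain ⟨z, h1, h2, h3⟩ := hne; exact ⟨z, by omega, h3⟩)
  have haz : a < z := by omega
  have hyz : y < z := by omega
  have hlt : I z a < I z y := by have := hle z haz hyz; omega
  have hd := (h.sep hy A.one hyz haz hlt hzmax).2
  rcases lt_trichotomy z b with hzb | rfl | hzb
  · have := A.mid z haz hzb hd
    have := h.le z y
    omega
  · exact hlt
  · have h1 := A.dd z hzb
    have hzn : z ≤ n := by
      by_contra hc
      rw [h.zero z y (by omega)] at hlt; omega
    have h2 := h.pl y b z hy hyb hzb hzn
    have := A.lts
    omega

/-- the vertices of `T^a ∖ 0` -/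
def PP (I : ℕ → ℕ → ℕ) (a x : ℕ) : Prop := x = a ∨ (1 ≤ x ∧ x < a ∧ DD I x a ∧ 0 < I a x)

theorem PP.dd {a x : ℕ} (h : PP I a x) : DD I x a := by
  rcases h with rfl | h
  · exact DD.refl _ _
  · exact h.2.2.1

theorem PP.le {a x : ℕ} (h : PP I a x) : x ≤ a := by
  rcases h with rfl | h <;> omega

theorem PP.one {a x : ℕ} (h : PP I a x) (ha : 1 ≤ a) : 1 ≤ x := by
  rcases h with rfl | h <;> omega

/-- if `x` is weakly after `a`, then it is in `P_a` or strictly after `a` at `b`. -/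
theorem Asc.aft {a b : ℕ} (A : Asc n s I a b) (h : IsInv n s I) {x : ℕ} (hx : 1 ≤ x) (hxa : x < a)
    (h0 : 0 < I a x) : PP I a x ∨ I b a < I b x := by
  by_cases hd : DD I x a
  · exact Or.inl (Or.inr ⟨hx, hxa, hd, h0⟩)
  · right
    apply A.right h hx (by have := A.lt; omega)
    · intro z hz _
      have := h.tr x a z hxa hz
      omega
    · unfold DD at hd
      push Not at hd
      obtain ⟨z, hz, hz'⟩ := hd
      exact ⟨z, hz, by omega, hz'⟩

theorem Asc.tr1 {a b : ℕ} (A : Asc n s I a b) (h : IsInv n s I) {x y : ℕ} (hx : 1 ≤ x)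
    (hxy : x < y) (hy : PP I a y) (h0 : 0 < I y x) : PP I a x ∨ I b a < I b x := by
  rcases hy with rfl | ⟨_, hya, hd, h1⟩
  · exact A.aft h hx hxy h0
  · apply A.aft h hx (by omega)
    have := h.tr x y a hxy hya
    omega

theorem Asc.pl1 {a b : ℕ} (A : Asc n s I a b) (h : IsInv n s I) {x y : ℕ} 
    (hxy : x < y) (hyb : y < b) (hx : PP I a x) : I y x = s y ∨ PP I a y ∨ I b a < I b y := by
  have hx1 := hx.one A.one
  by_cases h0 : I y x = s y
  · exact Or.inl h0
  right
  rcases lt_trichotomy y a with hya | rfl | hya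
  · apply A.aft h (by omega) hya
    rcases hx with rfl | hx
    · omega
    · have := h.pl x y a hx1 hxy hya (by have := A.lt; have := A.le; omega)
      omega
  · exact Or.inl (Or.inl rfl)
  · right
    have h1 : I y x = I y a := hx.dd y hya
    apply A.right h (by omega) hyb
    · intro z hz hyz
      by_cases hzn : z ≤ n
      · have := h.pl a y z A.one hya hyz hzn
        omega
      · rw [h.zero _ _ (by omega)]; omega
    · by_contra hc
      push Not at hc
      have : DD I a y := fun z hz => (hc z (by omega) hz).symm
      have := A.mid y hya hyb this
      omega

/-- single rotation -/
noncomputable def J1 (I : ℕ → ℕ → ℕ) (a b : ℕ) (y x : ℕ) : ℕ :=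
  if y = b ∧ PP I a x then I y x + 1 else I y x

theorem Asc.J1_trans {a b : ℕ} (A : Asc n s I a b) (h : IsInv n s I) :
    IsTransitiveInv (J1 I a b) := by
  intro x y z hxy hyz
  by_cases hx : 1 ≤ x
  swap
  · left
    unfold J1
    rw [if_neg, h.zero _ _ (by omega)]
    rintro ⟨_, hp⟩
    exact hx (hp.one A.one)
  have hab := A.lt
  unfold J1
  by_cases h1 : z = b ∧ PP I a y
  · obtain ⟨rfl, hy⟩ := h1
    have hyb : ¬ (y = z ∧ PP I a x) := by omega
    rw [if_neg hyb]
    by_cases h0 : I y x = 0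
    · exact Or.inl h0
    right
    have e1 : I z y = I z a := hy.dd z hab
    rcases A.tr1 h hx hxy hy (by omega) with h2 | h2
    · have e2 : I z x = I z a := h2.dd z hab
      simp [hy, h2, e1, e2]
    · rw [if_pos ⟨rfl, hy⟩]
      split_ifs <;> omega
  · rw [if_neg h1]
    by_cases h2 : y = b ∧ PP I a x
    · obtain ⟨rfl, h2⟩ := h2
      right
      have e1 : I z x = I z a := h2.dd z (by omega)
      have e2 : I z a = I z y := A.dd z hyz
      split_ifs <;> omega
    · rw [if_neg h2]
      have := h.tr x y z hxy hyz
      split_ifs <;> omega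

/-- the set of second coordinates added at `d`. -/
def QQ (I : ℕ → ℕ → ℕ) (a b c x : ℕ) : Prop := PP I c x ∨ (b = c ∧ I c a = 0 ∧ PP I a x)

/-- join of two rotations -/
noncomputable def J2 (I : ℕ → ℕ → ℕ) (a b c d : ℕ) (y x : ℕ) : ℕ :=
  if (y = b ∧ PP I a x) ∨ (y = d ∧ QQ I a b c x) then I y x + 1 else I y x

theorem J2_inv (h : IsInv n s I) {a b c d : ℕ} (A : Asc n s I a b) (C : Asc n s I c d)
    (hac : a < c) : IsInv n s (J2 I a b c d) := by
  have hab := A.lt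
  have hcd := C.lt
  have A1 := A.one
  have C1 := C.one
  have hbn := A.le
  have hdn := C.le
  have hQdd : ∀ x, QQ I a b c x → DD I x c := by
    rintro x (hx | ⟨rfl, _, hx⟩)
    · exact hx.dd
    · exact hx.dd.trans A.dd (by omega)
  have hQle : ∀ x, QQ I a b c x → x ≤ c := by
    rintro x (hx | ⟨rfl, _, hx⟩)
    · exact hx.le
    · have := hx.le; omega
  have hQ1 : ∀ x, QQ I a b c x → 1 ≤ x := by
    rintro x (hx | ⟨rfl, _, hx⟩)
    · exact hx.one C.one
    · exact hx.one A.one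
  have hge : ∀ y x, I y x ≤ J2 I a b c d y x := by
    intro y x; unfold J2; split_ifs <;> omega
  have hB : ∀ x, PP I a x → J2 I a b c d b x = I b a + 1 := by
    intro x hx; unfold J2; rw [if_pos (Or.inl ⟨rfl, hx⟩), hx.dd b hab]
  have hD : ∀ x, QQ I a b c x → J2 I a b c d d x = I d c + 1 := by
    intro x hx; unfold J2; rw [if_pos (Or.inr ⟨rfl, hx⟩), hQdd x hx d hcd]
  have hN : ∀ y x, ¬ ((y = b ∧ PP I a x) ∨ (y = d ∧ QQ I a b c x)) →
      J2 I a b c d y x = I y x := by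
    intro y x hx; unfold J2; rw [if_neg hx]
  have hle : ∀ y x, J2 I a b c d y x ≤ s y := by
    intro y x
    by_cases hc : (y = b ∧ PP I a x) ∨ (y = d ∧ QQ I a b c x)
    · rcases hc with ⟨rfl, hx⟩ | ⟨rfl, hx⟩
      · rw [hB x hx]; exact A.lts
      · rw [hD x hx]; exact C.lts
    · rw [hN _ _ hc]; exact h.le _ _
  refine ⟨?_, hle, ?_, ?_⟩
  · intro y x hr
    rw [hN, h.zero _ _ hr]
    rintro (⟨rfl, hx⟩ | ⟨rfl, hx⟩)
    · have := hx.one A1; have := hx.le; omega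
    · have := hQ1 x hx; have := hQle x hx; omega
  · intro x y z hxy hyz
    by_cases hx1 : 1 ≤ x
    swap
    · left
      rw [hN, h.zero _ _ (by omega)]
      rintro (⟨rfl, hx⟩ | ⟨rfl, hx⟩)
      · exact hx1 (hx.one A1)
      · exact hx1 (hQ1 x hx)
    by_cases h0 : I y x = 0
    · by_cases hc : (y = b ∧ PP I a x) ∨ (y = d ∧ QQ I a b c x)
      swap
      · left; rw [hN _ _ hc, h0]
      right
      have hdd : DD I x y := by
        rcases hc with ⟨rfl, hx⟩ | ⟨rfl, hx⟩
        · exact hx.dd.trans A.dd (by omega)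
        · exact (hQdd x hx).trans C.dd (by omega)
      by_cases hc2 : (z = b ∧ PP I a y) ∨ (z = d ∧ QQ I a b c y)
      swap
      · rw [hN _ _ hc2, ← hdd z hyz]; exact hge _ _
      rcases hc2 with ⟨rfl, hy⟩ | ⟨rfl, hy⟩
      · have := hy.le
        omega
      · have := hQle y hy
        rcases hc with ⟨rfl, hx⟩ | ⟨hh, hx⟩
        · rw [hD y hy, hD x]
          rcases hy with (hy | hy) | ⟨_, _, hy⟩
          · subst hy
            have e : I y x = I y a := hx.dd y hab
            exact Or.inr ⟨rfl, by omega, hx⟩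
          · left; right
            have hda : DD I x y := hdd
            have e : I c x = I c y := hdd c hy.2.1
            refine ⟨hx1, by omega, hdd.trans hy.2.2.1 (by omega), by omega⟩
          · have := hy.le; omega
        · omega
    · right
      by_cases hc2 : (z = b ∧ PP I a y) ∨ (z = d ∧ QQ I a b c y)
      swap
      · rw [hN _ _ hc2]
        have := h.tr x y z hxy hyz
        have := hge z x
        omega
      rcases hc2 with ⟨rfl, hy⟩ | ⟨rfl, hy⟩
      · rw [hB y hy]
        rcases A.tr1 h hx1 hxy hy (by omega) with h2 | h2
        · rw [hB x h2]
        · exact le_trans h2 (hge _ _)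
      · rw [hD y hy]
        rcases hy with hy | ⟨rfl, h00, hy⟩
        · rcases C.tr1 h hx1 hxy hy (by omega) with h2 | h2
          · rw [hD x (Or.inl h2)]
          · exact le_trans h2 (hge _ _)
        · rcases A.tr1 h hx1 hxy hy (by omega) with h2 | h2
          · rw [hD x (Or.inr ⟨rfl, h00, h2⟩)]
          · have := hy.le
            rcases C.aft h hx1 (by omega) (by omega : 0 < I b x) with h3 | h3
            · rw [hD x (Or.inl h3)]
            · exact le_trans h3 (hge _ _)
  · intro x y z hx1 hxy hyz hzn
    have fin1 : I y x = s y → J2 I a b c d y x = s y := by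
      intro e
      have := hge y x
      have := hle y x
      omega
    by_cases hc : (z = b ∧ PP I a x) ∨ (z = d ∧ QQ I a b c x)
    swap
    · rw [hN _ _ hc]
      rcases h.pl x y z hx1 hxy hyz hzn with e | e
      · exact Or.inl (fin1 e)
      · exact Or.inr (e.trans (hge _ _))
    rcases hc with ⟨rfl, hx⟩ | ⟨rfl, hx⟩
    · rw [hB x hx]
      rcases A.pl1 h hxy hyz hx with e | e | e
      · exact Or.inl (fin1 e)
      · right; rw [hB y e]
      · exact Or.inr (le_trans e (hge _ _))
    · rw [hD x hx]
      rcases hx with hx | ⟨rfl, h00, hx⟩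
      · rcases C.pl1 h hxy hyz hx with e | e | e
        · exact Or.inl (fin1 e)
        · right; rw [hD y (Or.inl e)]
        · exact Or.inr (le_trans e (hge _ _))
      · rcases lt_trichotomy y b with hyb | rfl | hyb
        · rcases A.pl1 h hxy hyb hx with e | e | e
          · exact Or.inl (fin1 e)
          · right; rw [hD y (Or.inr ⟨rfl, h00, e⟩)]
          · right
            rcases C.aft h (by omega) hyb (by omega : 0 < I b y) with h3 | h3
            · rw [hD y (Or.inl h3)]
            · exact le_trans h3 (hge _ _)
        · right; rw [hD y (Or.inl (Or.inl rfl))]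
        · rcases C.pl1 h hyb hyz (Or.inl rfl) with e | e | e
          · left; apply fin1
            rw [hx.dd y (by omega), A.dd y hyb, e]
          · right; rw [hD y (Or.inl e)]
          · exact Or.inr (le_trans e (hge _ _))

/-- labels in the interval below the join -/
theorem label_mem (h : IsInv n s I) {a b c d : ℕ} (A : Asc n s I a b) (C : Asc n s I c d)
    (hac : a < c) {K : ℕ → ℕ → ℕ} (hK : IsInv n s K) (hIK : ∀ y x, I y x ≤ K y x)
    (hKJ : ∀ y x, K y x ≤ J2 I a b c d y x) {a' b' : ℕ} (A' : Asc n s K a' b')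
    (hlt : K b' a' < J2 I a b c d b' a') : a' = a ∨ a' = c := by
  have hab := A.lt
  have hcd := C.lt
  have full : ∀ p q, Asc n s I p q → PP I p a' → a' ≠ p → p < b' → I p a' < K p a' := by
    intro p q P hp hne hpb
    rcases hp with hp | ⟨h1, h2, h3, h4⟩
    · exact absurd hp hne
    have := h.le p a'
    have := P.leaf a' h1 h2 h3 (by omega)
    by_contra hc
    have := hIK p a'
    have e : K p a' = I p a' := by omega
    have := A'.mid p h2 hpb (hK.dd_of_mid h1 h2 (by omega) (by omega))
    omega
  have noa : PP I a a' → a < b' → a' = a := by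
    intro hp hb
    by_contra hne
    have h1 := full a b A hp hne hb
    have h2 := hKJ a a'
    unfold J2 at h2
    rw [if_neg (by omega)] at h2
    omega
  have hadd : (b' = b ∧ PP I a a') ∨ (b' = d ∧ QQ I a b c a') := by
    by_contra hc
    unfold J2 at hlt
    rw [if_neg hc] at hlt
    have := hIK b' a'
    omega
  rcases hadd with ⟨rfl, hp⟩ | ⟨rfl, hp | ⟨rfl, _, hp⟩⟩
  · exact Or.inl (noa hp hab)
  · by_cases hne : a' = c
    · exact Or.inr hne
    have h1 := full c _ C hp hne hcd
    have h2 := hKJ c a'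
    unfold J2 at h2
    by_cases hc : (c = b ∧ PP I a a') ∨ (c = b' ∧ QQ I a b c a')
    · rcases hc with ⟨_, hp2⟩ | ⟨hh, _⟩
      · exact Or.inl (noa hp2 (by omega))
      · omega
    · rw [if_neg hc] at h2; omega
  · exact Or.inl (noa hp (by omega))

theorem step_a (h : IsInv n s I) {a b c d : ℕ} (A : Asc n s I a b) 
    (hac : a < c) (hcd : c < d) {K : ℕ → ℕ → ℕ} (hIK : ∀ y x, I y x ≤ K y x)
    (hKJ : ∀ y x, K y x ≤ J2 I a b c d y x) {b' : ℕ} (A' : Asc n s K c b')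
    (hlt : K b a < J1 K c b' b a) : False := by
  have hadd : b = b' ∧ PP K c a := by
    by_contra hc
    unfold J1 at hlt
    rw [if_neg hc] at hlt
    omega
  obtain ⟨rfl, hp⟩ := hadd
  have hcb := A'.lt
  rcases hp with hp | ⟨h1, h2, h3, h4⟩
  · omega
  have hk := hKJ c a
  unfold J2 at hk
  rw [if_neg (by omega)] at hk
  have hk2 := hIK c a
  have hs := h.le c a
  have := A'.leaf a h1 h2 h3 (by omega)
  have := A.mid c hac hcb (h.dd_of_mid h1 h2 (by omega) (by omega))
  omega

end inv

section tree
variable {n : ℕ} {s : ℕ → ℕ} (T : SDecTree n s)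

theorem descend_refl {x : ℕ} (h1 : 1 ≤ x) (h2 : x ≤ n) : T.Descend x x :=
  ⟨0, rfl, fun m hm => by obtain rfl : m = 0 := by omega
                          exact ⟨h1, h2⟩⟩

theorem descend_step {x y : ℕ} (h1 : 1 ≤ x) (h2 : x ≤ n) (h : T.Descend (T.parent x) y) :
    T.Descend x y := by
  obtain ⟨k, hk, hm⟩ := h
  refine ⟨k + 1, by simpa using hk, ?_⟩
  intro m hmk
  rcases m with _ | m
  · exact ⟨h1, h2⟩
  · simpa using hm m (by omega)

theorem descend_cases {x y : ℕ} (h : T.Descend x y) :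
    1 ≤ x ∧ x ≤ n ∧ (x = y ∨ (x < n ∧ T.Descend (T.parent x) y)) := by
  obtain ⟨k, hk, hm⟩ := h
  have h0 := hm 0 (by omega)
  simp only [Function.iterate_zero, id] at h0
  refine ⟨h0.1, h0.2, ?_⟩
  rcases k with _ | k
  · left; simpa using hk
  · right
    have h1 := hm 1 (by omega)
    simp only [Function.iterate_one] at h1
    refine ⟨?_, k, by simpa using hk, ?_⟩
    · by_contra hc
      rw [T.parent_out x (by omega)] at h1
      omega
    · intro m hmk
      simpa using hm (m + 1) (by omega)

/-- upward induction -/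
theorem up_ind {P : ℕ → Prop} (hP : ∀ x, 1 ≤ x → x ≤ n → (x < n → P (T.parent x)) → P x) :
    ∀ x, 1 ≤ x → x ≤ n → P x := by
  have : ∀ k x, 1 ≤ x → x ≤ n → n - x = k → P x := by
    intro k
    induction k using Nat.strong_induction_on with
    | _ k ih =>
      intro x h1 h2 hk
      apply hP x h1 h2
      intro h3
      have := T.parent_gt x h1 h3
      have := T.parent_le x h1 h3
      exact ih (n - T.parent x) (by omega) _ (by omega) (by omega) rfl
  intro x h1 h2
  exact this _ x h1 h2 rfl

theorem descend_range {x y : ℕ} (h : T.Descend x y) : 1 ≤ x ∧ x ≤ y ∧ y ≤ n := by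
  have hc := T.descend_cases h
  have : ∀ x, 1 ≤ x → x ≤ n → T.Descend x y → x ≤ y ∧ y ≤ n := by
    refine T.up_ind ?_
    intro x h1 h2 ih h
    rcases (T.descend_cases h).2.2 with rfl | ⟨h3, h4⟩
    · exact ⟨le_rfl, h2⟩
    · have := ih h3 h4
      have := T.parent_gt x h1 h3
      omega
  exact ⟨hc.1, this x hc.1 hc.2.1 h⟩

theorem descend_trans {x y z : ℕ} (h : T.Descend x y) (h' : T.Descend y z) : T.Descend x z := by
  have hc := T.descend_cases h
  have : ∀ x, 1 ≤ x → x ≤ n → T.Descend x y → T.Descend x z := by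
    refine T.up_ind ?_
    intro x h1 h2 ih h
    rcases (T.descend_cases h).2.2 with rfl | ⟨h3, h4⟩
    · exact h'
    · exact T.descend_step h1 h2 (ih h3 h4)
  exact this x hc.1 hc.2.1 h

theorem descend_root : ∀ x, 1 ≤ x → x ≤ n → T.Descend x n := by
  refine T.up_ind ?_
  intro x h1 h2 ih
  rcases h2.eq_or_lt with rfl | h3
  · exact T.descend_refl h1 le_rfl
  · exact T.descend_step h1 h2 (ih h3)

theorem descend_comp {x y z : ℕ} (h : T.Descend x y) (h' : T.Descend x z) (hyz : y ≤ z) :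
    T.Descend y z := by
  have hc := T.descend_cases h
  have : ∀ x, 1 ≤ x → x ≤ n → T.Descend x y → T.Descend x z → T.Descend y z := by
    refine T.up_ind ?_
    intro x h1 h2 ih h h'
    rcases (T.descend_cases h).2.2 with rfl | ⟨h3, h4⟩
    · exact h'
    · rcases (T.descend_cases h').2.2 with rfl | ⟨_, h6⟩
      · obtain rfl : x = y := by have := T.descend_range h; omega
        exact h'
      · exact ih h3 h4 h6
  exact (this x hc.1 hc.2.1 h h' : T.Descend y z)

theorem inSub_data {x y j : ℕ} (hy : 1 ≤ y) (h : T.InSub y j x) :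
    ∃ c, T.Descend x c ∧ T.parent c = y ∧ T.idx c = j ∧ 1 ≤ c ∧ c < n ∧ x ≤ c ∧ c < y ∧ y ≤ n := by
  obtain ⟨c, h1, h2, h3⟩ := h
  have hr := T.descend_range h1
  have hcn : c < n := by
    by_contra hc
    rw [T.parent_out c (by omega)] at h2
    omega
  have := T.parent_gt c (by omega) hcn
  have := T.parent_le c (by omega) hcn
  exact ⟨c, h1, h2, h3, by omega, hcn, hr.2.1, by omega, by omega⟩

theorem inSub_range {x y j : ℕ} (hy : 1 ≤ y) (h : T.InSub y j x) :
    1 ≤ x ∧ x < y ∧ y ≤ n ∧ T.Descend x y ∧ j ≤ s y := by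
  obtain ⟨c, h1, h2, h3, h4, h5, h6, h7, h8⟩ := T.inSub_data hy h
  have := T.idx_le c h4 h5
  refine ⟨(T.descend_range h1).1, by omega, h8, T.descend_trans h1 ?_, ?_⟩
  · apply T.descend_step h4 h5.le
    rw [h2]
    exact T.descend_refl hy h8
  · rw [← h2, ← h3]; exact this

theorem inSub_exists {x y : ℕ} (h : T.Descend x y) (hxy : x < y) : ∃ j, T.InSub y j x := by
  have hc := T.descend_cases h
  have : ∀ x, 1 ≤ x → x ≤ n → T.Descend x y → x < y → ∃ j, T.InSub y j x := by
    refine T.up_ind ?_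
    intro x h1 h2 ih h hxy
    rcases (T.descend_cases h).2.2 with rfl | ⟨h3, h4⟩
    · omega
    · rcases (T.descend_range h4).2.1.eq_or_lt with h5 | h5
      · exact ⟨T.idx x, x, T.descend_refl h1 h2, h5, rfl⟩
      · obtain ⟨j, c, h6, h7, h8⟩ := ih h3 h4 h5
        exact ⟨j, c, T.descend_step h1 h2 h6, h7, h8⟩
  exact this x hc.1 hc.2.1 h hxy

theorem inSub_of_desc {x y z j : ℕ} (h : T.Descend x y) (h' : T.InSub z j y) : T.InSub z j x := by
  obtain ⟨c, h1, h2, h3⟩ := h'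
  exact ⟨c, T.descend_trans h h1, h2, h3⟩

theorem inSub_up {x y z j : ℕ} (h : T.Descend x y) (hyz : y < z) (h' : T.InSub z j x) :
    T.InSub z j y := by
  obtain ⟨c, h1, h2, h3, h4, h5, h6, h7, h8⟩ := T.inSub_data (by omega) h'
  refine ⟨c, ?_, h2, h3⟩
  apply T.descend_comp h h1
  by_contra hc
  have h9 := T.descend_comp h1 h (by omega)
  rcases (T.descend_cases h9).2.2 with rfl | ⟨_, h10⟩
  · omega
  · have := T.descend_range h10
    omega

theorem inSub_unique {x y i j : ℕ} (hy : 1 ≤ y) (h : T.InSub y i x) (h' : T.InSub y j x) :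
    i = j := by
  obtain ⟨c, h1, h2, h3, h4, h5, h6, h7, h8⟩ := T.inSub_data hy h
  obtain ⟨e, h9, h10, h11⟩ := T.inSub_up h1 h7 h'
  rcases (T.descend_cases h9).2.2 with rfl | ⟨_, h12⟩
  · omega
  · rw [h2] at h12
    have := T.descend_range h12
    obtain ⟨_, _, _⟩ := this
    have hen : e < n := by
      by_contra hc
      rw [T.parent_out e (by omega)] at h10
      omega
    have := T.parent_gt e (by omega) hen
    omega

theorem leftOf_data {x y : ℕ} (h : T.LeftOf x y) : ∃ z j₁ j₂, j₁ < j₂ ∧ T.InSub z j₁ x ∧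
    T.InSub z j₂ y ∧ 1 ≤ z := by
  obtain ⟨z, i, j, hij, h1, h2⟩ := h
  refine ⟨z, i, j, hij, h1, h2, ?_⟩
  by_contra hc
  obtain rfl : z = 0 := by omega
  have : ∀ j x, T.InSub 0 j x → j = 0 := by
    rintro j x ⟨c, h3, h4, h5⟩
    have := T.descend_range h3
    by_cases hcn : c < n
    · have := T.parent_gt c (by omega) hcn
      omega
    · rw [T.idx_out c (by omega)] at h5
      exact h5.symm
  have e1 := this _ _ h1
  have e2 := this _ _ h2
  omega

theorem leftOf_irrefl {x : ℕ} : ¬ T.LeftOf x x := by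
  intro h
  obtain ⟨z, i, j, hij, h1, h2, h3⟩ := T.leftOf_data h
  have := T.inSub_unique h3 h1 h2
  omega

theorem leftOf_trans {x y z : ℕ} (h : T.LeftOf x y) (h' : T.LeftOf y z) : T.LeftOf x z := by
  obtain ⟨w, i, j, hij, h1, h2, h3⟩ := T.leftOf_data h
  obtain ⟨w', i', j', hij', h1', h2', h3'⟩ := T.leftOf_data h'
  have r := T.inSub_range h3 h2
  have r' := T.inSub_range h3' h1'
  rcases lt_trichotomy w w' with hw | rfl | hw
  · have h4 := T.inSub_up r.2.2.2.1 hw h1'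
    exact ⟨w', i', j', hij', T.inSub_of_desc (T.inSub_range h3 h1).2.2.2.1 h4, h2'⟩
  · have := T.inSub_unique h3 h2 h1'
    exact ⟨w, i, j', by omega, h1, h2'⟩
  · have h4 := T.inSub_up r'.2.2.2.1 hw h2
    exact ⟨w, i, j, hij, h1, T.inSub_of_desc (T.inSub_range h3' h2').2.2.2.1 h4⟩

theorem leftOf_total {x y : ℕ} (hx : 1 ≤ x) (hxy : x < y) (hy : y ≤ n) (hd : ¬ T.Descend x y) :
    T.LeftOf x y ∨ T.LeftOf y x := by
  classical
  have hex : ∃ w, T.Descend x w ∧ T.Descend y w :=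
    ⟨n, T.descend_root x hx (by omega), T.descend_root y (by omega) hy⟩
  obtain ⟨w, ⟨h1, h2⟩, hmin⟩ : ∃ w, (T.Descend x w ∧ T.Descend y w) ∧
      ∀ w', (T.Descend x w' ∧ T.Descend y w') → w ≤ w' :=
    ⟨Nat.find hex, Nat.find_spec hex, fun w' hw' => Nat.find_min' hex hw'⟩
  have hyw := (T.descend_range h2).2.1
  rcases hyw.eq_or_lt with rfl | hyw
  · exact absurd h1 hd
  obtain ⟨i, hi⟩ := T.inSub_exists h1 (by omega)
  obtain ⟨j, hj⟩ := T.inSub_exists h2 hyw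
  rcases lt_trichotomy i j with hij | rfl | hij
  · exact Or.inl ⟨w, i, j, hij, hi, hj⟩
  · obtain ⟨c, c1, c2, c3, c4, c5, c6, c7, c8⟩ := T.inSub_data (by omega) hi
    obtain ⟨e, e1, e2, e3, e4, e5, e6, e7, e8⟩ := T.inSub_data (by omega) hj
    obtain rfl := T.slot_inj c e c4 c5 e4 e5 (by omega) (by omega)
    have := hmin c ⟨c1, e1⟩
    omega
  · exact Or.inr ⟨w, j, i, hij, hj, hi⟩

theorem card_of_inSub {x y j : ℕ} (hy : 1 ≤ y) (h : T.InSub y j x) : T.card y x = j := by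
  have hex : ∃ j, T.InSub y j x := ⟨j, h⟩
  unfold card
  rw [dif_pos hex]
  exact T.inSub_unique hy hex.choose_spec h

theorem card_of_left {x y : ℕ} (hy : 1 ≤ y) (hd : ¬ T.Descend x y) (h : T.LeftOf x y) :
    T.card y x = 0 := by
  unfold card
  rw [dif_neg, if_neg (by tauto)]
  rintro ⟨j, hj⟩
  exact hd (T.inSub_range hy hj).2.2.2.1

theorem card_of_right {x y : ℕ} (hx : 1 ≤ x) (hxy : x < y) (hy : y ≤ n) (hd : ¬ T.Descend x y)
    (h : T.LeftOf y x) : T.card y x = s y := by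
  unfold card
  rw [dif_neg, if_pos]
  · refine ⟨hx, hxy, hy, fun h' => T.leftOf_irrefl (T.leftOf_trans h h')⟩
  rintro ⟨j, hj⟩
  exact hd (T.inSub_range (by omega) hj).2.2.2.1

theorem card_zero (y x : ℕ) (h : ¬ (1 ≤ x ∧ x < y ∧ y ≤ n)) : T.card y x = 0 := by
  by_cases hy : 1 ≤ y
  · unfold card
    rw [dif_neg, if_neg (by tauto)]
    rintro ⟨j, hj⟩
    have := T.inSub_range hy hj
    exact h ⟨this.1, this.2.1, this.2.2.1⟩
  · obtain rfl : y = 0 := by omega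
    unfold card
    split_ifs with h1 h2
    · obtain ⟨c, h3, h4, h5⟩ := h1.choose_spec
      rw [← h5]
      have := T.descend_range h3
      by_cases hcn : c < n
      · have := T.parent_gt c (by omega) hcn
        omega
      · exact T.idx_out c (by omega)
    · omega
    · rfl

theorem card_le (y x : ℕ) : T.card y x ≤ s y := by
  by_cases h : 1 ≤ x ∧ x < y ∧ y ≤ n
  · unfold card
    split_ifs with h1 h2
    · exact (T.inSub_range (by omega) h1.choose_spec).2.2.2.2
    · exact le_rfl
    · omega
  · rw [T.card_zero y x h]; omega

theorem leftOf_desc {x y z : ℕ} (h : T.Descend x y) (hyz : y < z) :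
    T.LeftOf x z ↔ T.LeftOf y z := by
  constructor
  · intro h'
    obtain ⟨w, i, j, hij, h1, h2, h3⟩ := T.leftOf_data h'
    have := T.inSub_range h3 h2
    exact ⟨w, i, j, hij, T.inSub_up h (by omega) h1, h2⟩
  · rintro ⟨w, i, j, hij, h1, h2⟩
    exact ⟨w, i, j, hij, T.inSub_of_desc h h1, h2⟩

theorem desc_dd {x y : ℕ} (h : T.Descend x y) : DD T.card x y := by
  intro z hyz
  have hr := T.descend_range h
  by_cases hd : T.Descend y z
  · obtain ⟨j, hj⟩ := T.inSub_exists hd hyz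
    rw [T.card_of_inSub (by omega) hj, T.card_of_inSub (by omega) (T.inSub_of_desc h hj)]
  · have hd' : ¬ T.Descend x z := fun h' => hd (T.descend_comp h h' hyz.le)
    have e1 : ¬ ∃ j, T.InSub z j x := by
      rintro ⟨j, hj⟩
      exact hd' (T.inSub_range (by omega) hj).2.2.2.1
    have e2 : ¬ ∃ j, T.InSub z j y := by
      rintro ⟨j, hj⟩
      exact hd (T.inSub_range (by omega) hj).2.2.2.1
    unfold card
    rw [dif_neg e1, dif_neg e2]
    simp only [T.leftOf_desc h hyz]
    have : (1 ≤ x ∧ x < z ∧ z ≤ n ∧ ¬ T.LeftOf y z) ↔ (1 ≤ y ∧ y < z ∧ z ≤ n ∧ ¬ T.LeftOf y z) :=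
      ⟨fun h => ⟨by omega, by omega, h.2.2⟩, fun h => ⟨by omega, by omega, h.2.2⟩⟩
    simp only [this]

theorem dd_desc {x y : ℕ} (hx : 1 ≤ x) (hxy : x < y) (hy : y ≤ n) (h : DD T.card x y) :
    T.Descend x y := by
  by_contra hd
  rcases T.leftOf_total hx hxy hy hd with h' | h'
  · obtain ⟨w, i, j, hij, h1, h2, h3⟩ := T.leftOf_data h'
    have := h w (T.inSub_range h3 h2).2.1
    rw [T.card_of_inSub h3 h1, T.card_of_inSub h3 h2] at this
    omega
  · obtain ⟨w, i, j, hij, h1, h2, h3⟩ := T.leftOf_data h'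
    have := h w (T.inSub_range h3 h1).2.1
    rw [T.card_of_inSub h3 h1, T.card_of_inSub h3 h2] at this
    omega

theorem card_left_le {p q z : ℕ} (h : T.LeftOf p q) (hp : p < z) (hq : q < z) (hz : z ≤ n) :
    T.card z p ≤ T.card z q := by
  obtain ⟨w, i, j, hij, h1, h2, h3⟩ := T.leftOf_data h
  have r1 := T.inSub_range h3 h1
  have r2 := T.inSub_range h3 h2
  by_cases hdp : T.Descend p z
  · rcases lt_trichotomy z w with hw | rfl | hw
    · have h4 := T.inSub_up hdp hw h1
      have hl : T.LeftOf z q := ⟨w, i, j, hij, h4, h2⟩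
      rw [T.card_of_right r2.1 hq hz _ hl]
      · exact T.card_le _ _
      · intro hdq
        have := T.inSub_unique h3 h2 (T.inSub_of_desc hdq h4)
        omega
    · rw [T.card_of_inSub h3 h1, T.card_of_inSub h3 h2]
      omega
    · rw [T.desc_dd r1.2.2.2.1 z hw, T.desc_dd r2.2.2.2.1 z hw]
  · by_cases hl : T.LeftOf p z
    · rw [T.card_of_left (by omega) hdp hl]; omega
    · have hr : T.LeftOf z p := by
        rcases T.leftOf_total r1.1 hp hz hdp with h4 | h4
        · exact absurd h4 hl
        · exact h4
      have hr2 := T.leftOf_trans hr h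
      rw [T.card_of_right r2.1 hq hz _ hr2]
      · exact T.card_le _ _
      · intro hdq
        obtain ⟨w', i', j', hij', h1', h2', h3'⟩ := T.leftOf_data hr2
        have := T.inSub_unique h3' h2' (T.inSub_of_desc hdq h1')
        omega

theorem card_inv : IsInv n s T.card := by
  refine ⟨T.card_zero, T.card_le, ?_, ?_⟩
  · intro x y z hxy hyz
    by_cases hr : 1 ≤ x ∧ z ≤ n
    swap
    · by_cases hx : 1 ≤ x
      · right; rw [T.card_zero z y (by omega)]; omega
      · left; exact T.card_zero _ _ (by omega)
    by_cases hd : T.Descend x y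
    · right; rw [T.desc_dd hd z hyz]
    rcases T.leftOf_total hr.1 hxy (by omega) hd with h | h
    · left; exact T.card_of_left (by omega) hd h
    · right; exact T.card_left_le h hyz (by omega) hr.2
  · intro x y z hx hxy hyz hzn
    by_cases hd : T.Descend x y
    · right; rw [T.desc_dd hd z hyz]
    rcases T.leftOf_total hx hxy (by omega) hd with h | h
    · right; exact T.card_left_le h (by omega) hyz hzn
    · left; exact T.card_of_right hx hxy (by omega) hd h

theorem inSub_iff {x y j : ℕ} (hx : 1 ≤ x) (hxy : x < y) (hy : y ≤ n) :
    T.InSub y j x ↔ DD T.card x y ∧ T.card y x = j := by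
  constructor
  · intro h
    exact ⟨T.desc_dd (T.inSub_range (by omega) h).2.2.2.1, T.card_of_inSub (by omega) h⟩
  · rintro ⟨h, rfl⟩
    obtain ⟨j, hj⟩ := T.inSub_exists (T.dd_desc hx hxy hy h) hxy
    rwa [T.card_of_inSub (by omega) hj]

theorem TreeAscent.asc {T : SDecTree n s} {a b : ℕ} (h : T.TreeAscent a b) :
    Asc n s T.card a b := by
  obtain ⟨h1, h2, h3, ⟨i, hi, h4⟩, h5, h6⟩ := h
  rw [T.inSub_iff h1 h2 h3] at h4
  refine ⟨h1, h2, h3, h4.1, by omega, ?_, ?_⟩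
  · intro e he heb hd
    exact h5 e _ he heb ((T.inSub_iff h1 he (by omega)).2 ⟨hd, rfl⟩)
  · intro x hx hxa hd hs
    have := h6 hs x
    rw [T.inSub_iff hx hxa (by omega)] at this
    have h7 := T.card_le a x
    have : T.card a x ≠ s a := fun h => this ⟨hd, h⟩
    omega

theorem parent_min {x y : ℕ} (hx : 1 ≤ x) (hxn : x < n) (h : T.Descend x y) (hxy : x < y) :
    T.parent x ≤ y := by
  rcases (T.descend_cases h).2.2 with rfl | ⟨_, h4⟩
  · omega
  · exact (T.descend_range h4).2.1

theorem card_inj {T Z : SDecTree n s} (h : T.card = Z.card) : T = Z := by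
  have hd : ∀ (T Z : SDecTree n s), T.card = Z.card → ∀ x, 1 ≤ x → x < n →
      Z.parent x ≤ T.parent x := by
    intro T Z h x hx hxn
    have g1 := T.parent_gt x hx hxn
    have g2 := T.parent_le x hx hxn
    have h1 : T.Descend x (T.parent x) :=
      T.descend_step hx hxn.le (T.descend_refl (by omega) g2)
    have h2 := T.desc_dd h1
    rw [h] at h2
    exact Z.parent_min hx hxn (Z.dd_desc hx g1 g2 h2) g1
  have hp : T.parent = Z.parent := by
    funext x
    by_cases hx : 1 ≤ x ∧ x < n
    · exact le_antisymm (hd Z T h.symm x hx.1 hx.2) (hd T Z h x hx.1 hx.2)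
    · rw [T.parent_out x (by omega), Z.parent_out x (by omega)]
  have hi : T.idx = Z.idx := by
    funext x
    by_cases hx : 1 ≤ x ∧ x < n
    · have key : ∀ T : SDecTree n s, T.card (T.parent x) x = T.idx x := by
        intro T
        have g1 := T.parent_gt x hx.1 hx.2
        exact T.card_of_inSub (by omega) ⟨x, T.descend_refl hx.1 (by omega), rfl, rfl⟩
      rw [← key T, ← key Z, h, hp]
    · rw [T.idx_out x (by omega), Z.idx_out x (by omega)]
  cases T; cases Z
  simp only at hp hi
  subst hp; subst hi
  rfl

end tree

section construct
variable {n : ℕ} {s : ℕ → ℕ} {I : ℕ → ℕ → ℕ}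

theorem IsInv.ex_par (h : IsInv n s I) {x : ℕ} (hx : x < n) : ∃ y, x < y ∧ DD I x y :=
  ⟨n, hx, fun z hz => by rw [h.zero _ _ (by omega), h.zero _ _ (by omega)]⟩

/-- parent function of the tree of an inversion set -/
noncomputable def par (n : ℕ) (I : ℕ → ℕ → ℕ) (x : ℕ) : ℕ :=
  if h : (1 ≤ x ∧ x < n) ∧ ∃ y, x < y ∧ DD I x y then Nat.find h.2 else 0

theorem IsInv.par_spec (h : IsInv n s I) {x : ℕ} (h1 : 1 ≤ x) (h2 : x < n) :
    x < par n I x ∧ DD I x (par n I x) ∧ par n I x ≤ n ∧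
      ∀ y, x < y → DD I x y → par n I x ≤ y := by
  have hh : (1 ≤ x ∧ x < n) ∧ ∃ y, x < y ∧ DD I x y := ⟨⟨h1, h2⟩, h.ex_par h2⟩
  unfold par
  rw [dif_pos hh]
  have := Nat.find_spec hh.2
  refine ⟨this.1, this.2, ?_, fun y h3 h4 => Nat.find_min' hh.2 ⟨h3, h4⟩⟩
  exact Nat.find_min' hh.2 ⟨h2, fun z hz => by rw [h.zero _ _ (by omega), h.zero _ _ (by omega)]⟩

theorem par_out {x : ℕ} (h : x = 0 ∨ n ≤ x) : par n I x = 0 := by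
  unfold par
  rw [dif_neg]
  omega

theorem IsInv.par_inj (h : IsInv n s I) {v w : ℕ} (hv : 1 ≤ v) (hvw : v < w) (hw : w < n)
    (hp : par n I v = par n I w) (hi : I (par n I v) v = I (par n I w) w) : False := by
  obtain ⟨v1, v2, v3, v4⟩ := h.par_spec hv (by omega : v < n)
  obtain ⟨w1, w2, w3, w4⟩ := h.par_spec (by omega : 1 ≤ w) hw
  have hd : DD I v w := by
    by_contra hd
    unfold DD at hd
    push Not at hd
    obtain ⟨z, hz, hne, hmax⟩ := h.exists_sep (x := v) (y := w) (m := w) hd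
    have hzp : z < par n I w := by
      by_contra hc
      rcases (not_lt.1 hc).eq_or_lt with e | e
      · rw [← e] at hne
        rw [hp] at hi
        exact hne hi
      · apply hne
        rw [w2 z e, v2 z (by omega), hp]
    have hdz : DD I w z := by
      rcases lt_or_gt_of_ne hne with hl | hl
      · exact (h.sep (by omega) hv hz (by omega) hl (fun u hu => (hmax u hu).symm)).1
      · exact (h.sep hv (by omega) (by omega) hz hl hmax).2
    have := w4 z hz hdz
    omega
  have := v4 w hvw hd
  omega

/-- tree of an inversion set -/
noncomputable def IsInv.toTree (h : IsInv n s I) : SDecTree n s where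
  parent := par n I
  idx := fun x => if 1 ≤ x ∧ x < n then I (par n I x) x else 0
  parent_gt := fun v h1 h2 => (h.par_spec h1 h2).1
  parent_le := fun v h1 h2 => (h.par_spec h1 h2).2.2.1
  idx_le := fun v h1 h2 => by rw [if_pos ⟨h1, h2⟩]; exact h.le _ _
  slot_inj := fun v w h1 h2 h3 h4 hp hi => by
    rw [if_pos ⟨h1, h2⟩, if_pos ⟨h3, h4⟩] at hi
    rcases lt_trichotomy v w with hl | hl | hl
    · exact (h.par_inj h1 hl h4 hp hi).elim
    · exact hl
    · exact (h.par_inj h3 hl h2 hp.symm hi.symm).elim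
  parent_out := fun v hv => par_out hv
  idx_out := fun v hv => by rw [if_neg (by omega)]

theorem IsInv.desc_iff (h : IsInv n s I) {y : ℕ} (hy : y ≤ n) :
    ∀ x, 1 ≤ x → x ≤ n → (x ≤ y → (h.toTree.Descend x y ↔ DD I x y)) := by
  refine h.toTree.up_ind ?_
  intro x h1 h2 ih hxy
  rcases hxy.eq_or_lt with rfl | hlt
  · exact ⟨fun _ => DD.refl _ _, fun _ => h.toTree.descend_refl h1 h2⟩
  obtain ⟨p1, p2, p3, p4⟩ := h.par_spec h1 (by omega : x < n)
  have ih' := ih (by omega)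
  constructor
  · intro hd
    rcases (h.toTree.descend_cases hd).2.2 with e | ⟨_, h4⟩
    · omega
    · have hr := (h.toTree.descend_range h4).2.1
      exact DD.trans p2 ((ih' hr).1 h4) hr
  · intro hd
    have hr := p4 y hlt hd
    exact h.toTree.descend_step h1 h2 ((ih' hr).2 (DD.cancel p2 hd hr))

theorem IsInv.inSub_eq (h : IsInv n s I) {x y j : ℕ} (hy : 1 ≤ y) (hj : h.toTree.InSub y j x) :
    I y x = j := by
  obtain ⟨c, c1, c2, c3, c4, c5, c6, c7, c8⟩ := h.toTree.inSub_data hy hj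
  have r := h.toTree.descend_range c1
  have hd := (h.desc_iff r.2.2 x r.1 (by omega) r.2.1).1 c1
  have e : h.toTree.idx c = I (h.toTree.parent c) c := by
    change (if 1 ≤ c ∧ c < n then I (par n I c) c else 0) = _
    rw [if_pos ⟨c4, c5⟩]; rfl
  rw [hd y c7, ← c3, e, c2]

theorem IsInv.toTree_card (h : IsInv n s I) : h.toTree.card = I := by
  funext y x
  by_cases hr : 1 ≤ x ∧ x < y ∧ y ≤ n
  swap
  · rw [h.toTree.card_zero y x hr, h.zero y x hr]
  obtain ⟨hx, hxy, hy⟩ := hr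
  by_cases hd : h.toTree.Descend x y
  · obtain ⟨j, hj⟩ := h.toTree.inSub_exists hd hxy
    rw [h.toTree.card_of_inSub (by omega) hj, h.inSub_eq (by omega) hj]
  · rcases h.toTree.leftOf_total hx hxy hy hd with hl | hl
    · rw [h.toTree.card_of_left (by omega) hd hl]
      obtain ⟨w, i, j, hij, h1, h2, h3⟩ := h.toTree.leftOf_data hl
      have e1 := h.inSub_eq h3 h1
      have e2 := h.inSub_eq h3 h2
      have := h.tr x y w hxy (h.toTree.inSub_range h3 h2).2.1
      omega
    · rw [h.toTree.card_of_right hx hxy hy hd hl]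
      obtain ⟨w, i, j, hij, h1, h2, h3⟩ := h.toTree.leftOf_data hl
      have e1 := h.inSub_eq h3 h1
      have e2 := h.inSub_eq h3 h2
      have r := h.toTree.inSub_range h3 h1
      have := h.pl x y w hx hxy r.2.1 r.2.2.1
      omega

end construct

section rot
variable {n : ℕ} {s : ℕ → ℕ}

theorem IsRotation.bump {T Z : SDecTree n s} {a b : ℕ} (h : T.IsRotation Z a b) :
    T.card b a < Z.card b a := by
  have A := h.1.asc
  rw [h.2 b a A.one A.lt A.le]
  have hne : {m | ∃ J : ℕ → ℕ → ℕ, IsTransitiveInv J ∧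
      (∀ y' x', addInv s T.card b a y' x' ≤ J y' x') ∧ J b a = m}.Nonempty := by
    refine ⟨s b, fun y _ => s y, fun _ _ _ _ _ => Or.inr le_rfl, ?_, rfl⟩
    intro y x
    have := T.card_le y x
    change addInv s T.card b a y x ≤ s y
    unfold addInv
    split_ifs <;> omega
  obtain ⟨J, _, h2, h3⟩ := Nat.sInf_mem hne
  have h4 := h2 b a
  rw [h3] at h4
  unfold addInv at h4
  rw [if_pos ⟨rfl, rfl⟩] at h4
  have := A.lts
  unfold tcInv
  unfold addInv
  omega

theorem IsRotation.le_of {T Z : SDecTree n s} {a b : ℕ} (h : T.IsRotation Z a b)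
    {J : ℕ → ℕ → ℕ} (hJ : IsTransitiveInv J) (hle : ∀ y x, T.card y x ≤ J y x)
    (hb : T.card b a + 1 ≤ J b a) : ∀ y x, Z.card y x ≤ J y x := by
  intro y x
  by_cases hr : 1 ≤ x ∧ x < y ∧ y ≤ n
  swap
  · rw [Z.card_zero y x hr]; omega
  rw [h.2 y x hr.1 hr.2.1 hr.2.2]
  apply Nat.sInf_le
  refine ⟨J, hJ, ?_, rfl⟩
  intro y' x'
  have := hle y' x'
  unfold addInv
  split_ifs with hc
  · obtain ⟨rfl, rfl⟩ := hc
    omega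
  · exact this

theorem IsRotation.le_J1 {T Z : SDecTree n s} {a b : ℕ} (h : T.IsRotation Z a b) :
    ∀ y x, Z.card y x ≤ J1 T.card a b y x := by
  apply h.le_of (h.1.asc.J1_trans T.card_inv)
  · intro y x; unfold J1; split_ifs <;> omega
  · unfold J1; rw [if_pos ⟨rfl, Or.inl rfl⟩]

theorem Asc.unique {I : ℕ → ℕ → ℕ} {a b d : ℕ} (A : Asc n s I a b) (C : Asc n s I a d) :
    b = d := by
  rcases lt_trichotomy b d with h | h | h
  · have := C.mid b A.lt h A.dd; have := A.lts; omega
  · exact h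
  · have := A.mid d C.lt h C.dd; have := C.lts; omega

theorem chain_facts (lab : SDecTree n s → SDecTree n s → ℕ) (j : SDecTree n s) :
    ∀ (L : List (SDecTree n s)) (u : SDecTree n s), List.IsChain wcov L →
      L.head? = some u → L.getLast? = some j →
      wle u j ∧
      (∀ l ∈ labelsOf lab L, ∃ T Z, wcov T Z ∧ wle u T ∧ wle Z j ∧ l = lab T Z) ∧
      (∀ y x, u.card y x < j.card y x → ∃ T Z, wcov T Z ∧ wle u T ∧ wle Z j ∧
        T.card y x < Z.card y x ∧ lab T Z ∈ labelsOf lab L) := by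
  intro L
  induction L with
  | nil => intro u _ h; simp at h
  | cons p L ih =>
    intro u hc hh hl
    obtain rfl : p = u := by simpa using hh
    rcases L with _ | ⟨q, L⟩
    · obtain rfl : p = j := by simpa using hl
      refine ⟨fun _ _ => le_rfl, ?_, ?_⟩
      · intro l hl; simp [labelsOf] at hl
      · intro y x h; omega
    · rw [List.isChain_cons_cons] at hc
      obtain ⟨h1, h2, h3⟩ := ih q hc.2 (by simp) (by simpa using hl)
      have hpq : wle p q := hc.1.1.1
      have hlab : labelsOf lab (p :: q :: L) = lab p q :: labelsOf lab (q :: L) := by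
        simp [labelsOf]
      rw [hlab]
      refine ⟨fun y x => (hpq y x).trans (h1 y x), ?_, ?_⟩
      · intro l hl
        rcases List.mem_cons.1 hl with rfl | hl
        · exact ⟨p, q, hc.1, fun _ _ => le_rfl, h1, rfl⟩
        · obtain ⟨T, Z, g1, g2, g3, g4⟩ := h2 l hl
          exact ⟨T, Z, g1, fun y x => (hpq y x).trans (g2 y x), g3, g4⟩
      · intro y x hlt
        by_cases hq : p.card y x < q.card y x
        · exact ⟨p, q, hc.1, fun _ _ => le_rfl, h1, hq, by simp⟩
        · have := hpq y x
          obtain ⟨T, Z, g1, g2, g3, g4, g5⟩ := h3 y x (by omega)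
          exact ⟨T, Z, g1, fun y x => (hpq y x).trans (g2 y x), g3, g4,
            List.mem_cons_of_mem _ g5⟩

theorem sb_core (lab : SDecTree n s → SDecTree n s → ℕ)
    (hlab : ∀ T Z : SDecTree n s, wcov T Z →
      ∃ b, T.TreeAscent (lab T Z) b ∧ IsRotation T Z (lab T Z) b)
    (u v w : SDecTree n s) (huv : wcov u v) (huw : wcov u w) (hlt : lab u v < lab u w)
    (j : SDecTree n s) (hj : IsJoin v w j) (L : List (SDecTree n s))
    (hL : List.IsChain wcov L) (hh : L.head? = some u) (hl : L.getLast? = some j) :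
    (lab u v ∈ labelsOf lab L ∧ lab u w ∈ labelsOf lab L) ∧
          ∀ l ∈ labelsOf lab L, l = lab u v ∨ l = lab u w := by
  obtain ⟨b, _, R1⟩ := hlab u v huv
  obtain ⟨d, _, R2⟩ := hlab u w huw
  generalize lab u v = a at *
  generalize lab u w = c at *
  have A := R1.1.asc
  have C := R2.1.asc
  have hu := u.card_inv
  have hJ := J2_inv hu A C hlt
  have hge : ∀ y x, u.card y x ≤ J2 u.card a b c d y x := by
    intro y x; unfold J2; split_ifs <;> omega
  have hv : wle v hJ.toTree := by
    unfold wle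
    rw [hJ.toTree_card]
    apply R1.le_of hJ.tr hge
    unfold J2; rw [if_pos (Or.inl ⟨rfl, Or.inl rfl⟩)]
  have hw : wle w hJ.toTree := by
    unfold wle
    rw [hJ.toTree_card]
    apply R2.le_of hJ.tr hge
    unfold J2; rw [if_pos (Or.inr ⟨rfl, Or.inl (Or.inl rfl)⟩)]
  have hjJ := hj.2.2 _ hv hw
  unfold wle at hjJ
  rw [hJ.toTree_card] at hjJ
  obtain ⟨_, f2, f3⟩ := chain_facts lab j L u hL hh hl
  have mem : ∀ T Z, wcov T Z → wle u T → wle Z j → lab T Z = a ∨ lab T Z = c := by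
    intro T Z h1 h2 h3
    obtain ⟨b', _, R⟩ := hlab T Z h1
    exact label_mem hu A C hlt T.card_inv h2
      (fun y x => (h1.1.1 y x).trans ((h3 y x).trans (hjJ y x))) R.1.asc
      (lt_of_lt_of_le R.bump ((h3 _ _).trans (hjJ _ _)))
  refine ⟨⟨?_, ?_⟩, ?_⟩
  · obtain ⟨T, Z, g1, g2, g3, g4, g5⟩ := f3 b a (lt_of_lt_of_le R1.bump (hj.1 _ _))
    rcases mem T Z g1 g2 g3 with e | e
    · rwa [e] at g5
    · exfalso
      obtain ⟨b', _, R⟩ := hlab T Z g1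
      rw [e] at R
      exact step_a hu A hlt C.lt g2
        (fun y x => (g1.1.1 y x).trans ((g3 y x).trans (hjJ y x))) R.1.asc
        (lt_of_lt_of_le g4 (R.le_J1 _ _))
  · obtain ⟨T, Z, g1, g2, g3, g4, g5⟩ := f3 d c (lt_of_lt_of_le R2.bump (hj.2.1 _ _))
    rcases mem T Z g1 g2 g3 with e | e
    · exfalso
      obtain ⟨b', _, R⟩ := hlab T Z g1
      rw [e] at R
      have h5 := lt_of_lt_of_le g4 (R.le_J1 _ _)
      unfold J1 at h5
      split_ifs at h5 with h6
      · have := h6.2.le; omega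
      · omega
    · rwa [e] at g5
  · intro l hl
    obtain ⟨T, Z, g1, g2, g3, rfl⟩ := f2 l hl
    exact mem T Z g1 g2 g3

end rot

end SDecTree

/-- the labeling of cover relations of the `s`-weak order by the smaller
element of the associated tree ascent is an SB-labeling: for distinct covers `v, w` of
`u`, the labels `λ(u,v)` and `λ(u,w)` differ, and every saturated chain from `u` to
`v ∨ w` uses both of these labels and no others. -/
theorem sb_labeling_s_weak_order (n : ℕ) (s : ℕ → ℕ)
    (lab : SDecTree n s → SDecTree n s → ℕ)
    (hlab : ∀ T Z : SDecTree n s, SDecTree.wcov T Z →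
      ∃ b, T.TreeAscent (lab T Z) b ∧ SDecTree.IsRotation T Z (lab T Z) b) :
    ∀ u v w : SDecTree n s, SDecTree.wcov u v → SDecTree.wcov u w → v ≠ w →
      ∀ j, SDecTree.IsJoin v w j →
        lab u v ≠ lab u w ∧
        ∀ L : List (SDecTree n s), List.Chain' SDecTree.wcov L →
          L.head? = some u → L.getLast? = some j →
          (lab u v ∈ labelsOf lab L ∧ lab u w ∈ labelsOf lab L) ∧
          ∀ l ∈ labelsOf lab L, l = lab u v ∨ l = lab u w := by
  intro u v w huv huw hne j hj
  have hlne : lab u v ≠ lab u w := by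
    intro e
    obtain ⟨b, _, R1⟩ := hlab u v huv
    obtain ⟨d, _, R2⟩ := hlab u w huw
    rw [e] at R1
    obtain rfl := R1.1.asc.unique R2.1.asc
    apply hne
    apply SDecTree.card_inj
    funext y x
    by_cases hr : 1 ≤ x ∧ x < y ∧ y ≤ n
    · rw [R1.2 y x hr.1 hr.2.1 hr.2.2, R2.2 y x hr.1 hr.2.1 hr.2.2]
    · rw [v.card_zero y x hr, w.card_zero y x hr]
  refine ⟨hlne, ?_⟩
  intro L hL hh hl
  rcases lt_or_gt_of_ne hlne with h | h
  · exact SDecTree.sb_core lab hlab u v w huv huw h j hj L hL hh hl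
  · have := SDecTree.sb_core lab hlab u w v huw huv h j
      ⟨hj.2.1, hj.1, fun U h1 h2 => hj.2.2 U h2 h1⟩ L hL hh hl
    exact ⟨⟨this.1.2, this.1.1⟩, fun l hl => (this.2 l hl).symm⟩
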